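/- arXiv:1706.08118 — 2 statements merged into one kernel-verified Lean document; each statement's English description precedes it below -/
import Mathlib

section
/- Let d ∈ ℕ, h a dimension function with h ≺ x^d, and (α_n)_{n∈ℕ} ⊆ ℝ \ {0}. Then there exists a compact set E ⊆ ℝ^d with ℋ^h(E) > 0 such that for all n, E contains no four distinct points x₁, x₂, x₃, x₄ with x₁ − x₂ = α_n·(x₃ − x₄); in particular E contains no vertices of any trapezoid whose parallel sides have length ratio α_n. -/
open MeasureTheory Filter Set

/-- A dimension function: vanishes at 0, positive on positives, increasing,
right-continuous. -/
def IsDimFun (h : ℝ → ℝ) : Prop :=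
  h 0 = 0 ∧ (∀ t > 0, 0 < h t) ∧ MonotoneOn h (Set.Ici 0) ∧
    ∀ t ∈ Set.Ici (0 : ℝ), ContinuousWithinAt h (Set.Ici t) t

/-- The Hausdorff measure associated to a gauge (dimension) function `h`. -/
noncomputable def gaugeMeasure {X : Type*} [EMetricSpace X] [MeasurableSpace X]
    [BorelSpace X] (h : ℝ → ℝ) : Measure X :=
  Measure.mkMetric fun r => ENNReal.ofReal (h r.toReal)

/-- `Prec h₂ h₁` means `h₂ ≺ h₁`, i.e. `lim_{x→0⁺} h₁ x / h₂ x = 0`. -/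
def Prec (h₂ h₁ : ℝ → ℝ) : Prop :=
  Tendsto (fun x => h₁ x / h₂ x) (nhdsWithin 0 (Set.Ioi 0)) (nhds 0)

/-- The numerical data of a Cantor construction in `Fin d → ℝ`. A cube of generation `k` with
lower corner `a` has side length `side k`; its `count k ^ d` children have their lower corners
in the lattice `mesh k a • ℤ ^ d` translated by `shift k a` in every coordinate. -/
structure LatticeScheme (d : ℕ) where
  side : ℕ → ℝ
  count : ℕ → ℕ
  mesh : ℕ → (Fin d → ℝ) → ℝ
  shift : ℕ → (Fin d → ℝ) → ℝ
  side_pos : ∀ k, 0 < side k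
  count_pos : ∀ k, 0 < count k
  shift_nonneg : ∀ k a, 0 ≤ shift k a
  side_le_mesh : ∀ k a, 8 * side (k + 1) ≤ mesh k a
  fits : ∀ k a, mesh k a * count k + shift k a + side (k + 1) ≤ side k

namespace LatticeScheme

variable {d : ℕ} (S : LatticeScheme d)

instance (k : ℕ) : NeZero (S.count k) := ⟨(S.count_pos k).ne'⟩

/-- The space of digit sequences labelling the branches of the construction. -/
abbrev Digits : Type := ∀ k, Fin d → Fin (S.count k)

/-- The lower corner of the generation `k` cube on the branch `ω`. -/
noncomputable def corner (ω : S.Digits) : ℕ → Fin d → ℝ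
  | 0 => 0
  | k + 1 => fun l =>
      S.mesh k (corner ω k) * (⌈corner ω k l / S.mesh k (corner ω k)⌉ + ((ω k l : ℕ) : ℝ)) +
        S.shift k (corner ω k)

/-- The point at the end of the branch `ω`. -/
noncomputable def point (ω : S.Digits) : Fin d → ℝ := fun l => ⨆ k, S.corner ω k l

lemma mesh_pos (k : ℕ) (a : Fin d → ℝ) : 0 < S.mesh k a := by
  linarith [S.side_le_mesh k a, S.side_pos (k + 1)]

lemma corner_le_succ (ω : S.Digits) (k : ℕ) (l : Fin d) :
    S.corner ω k l ≤ S.corner ω (k + 1) l := by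
  have hm := S.mesh_pos k (S.corner ω k)
  have h1 : S.corner ω k l ≤
      S.mesh k (S.corner ω k) * ⌈S.corner ω k l / S.mesh k (S.corner ω k)⌉ := by
    rw [← div_le_iff₀' hm]
    exact Int.le_ceil _
  have h2 : 0 ≤ S.mesh k (S.corner ω k) * ((ω k l : ℕ) : ℝ) := by positivity
  simp only [corner, mul_add]
  linarith [S.shift_nonneg k (S.corner ω k)]

lemma corner_succ_add_side_le (ω : S.Digits) (k : ℕ) (l : Fin d) :
    S.corner ω (k + 1) l + S.side (k + 1) ≤ S.corner ω k l + S.side k := by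
  have hm := S.mesh_pos k (S.corner ω k)
  have h1 : S.mesh k (S.corner ω k) * ⌈S.corner ω k l / S.mesh k (S.corner ω k)⌉ ≤
      S.corner ω k l + S.mesh k (S.corner ω k) := by
    have := (Int.ceil_lt_add_one (S.corner ω k l / S.mesh k (S.corner ω k))).le
    calc _ ≤ S.mesh k (S.corner ω k) * (S.corner ω k l / S.mesh k (S.corner ω k) + 1) := by gcongr
      _ = _ := by field_simp
  have h2 : S.mesh k (S.corner ω k) * ((ω k l : ℕ) : ℝ) + S.mesh k (S.corner ω k) ≤
      S.mesh k (S.corner ω k) * S.count k := by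
    have : ((ω k l : ℕ) : ℝ) + 1 ≤ S.count k := by exact_mod_cast (ω k l).isLt
    calc _ = S.mesh k (S.corner ω k) * (((ω k l : ℕ) : ℝ) + 1) := by ring
      _ ≤ _ := by gcongr
  simp only [corner, mul_add]
  linarith [S.fits k (S.corner ω k)]

lemma corner_le_corner_add_side (ω : S.Digits) (i j : ℕ) (l : Fin d) :
    S.corner ω i l ≤ S.corner ω j l + S.side j := by
  have hmono : Monotone fun k => S.corner ω k l :=
    monotone_nat_of_le_succ fun k => S.corner_le_succ ω k l
  have hanti : Antitone fun k => S.corner ω k l + S.side k :=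
    antitone_nat_of_succ_le fun k => S.corner_succ_add_side_le ω k l
  have h1 := hmono (le_max_left i j)
  have h2 := hanti (le_max_right i j)
  have h3 := S.side_pos (max i j)
  simp only at h1 h2
  linarith

lemma corner_le_point (ω : S.Digits) (k : ℕ) (l : Fin d) : S.corner ω k l ≤ S.point ω l :=
  le_ciSup (f := fun k => S.corner ω k l)
    ⟨_, by rintro _ ⟨i, rfl⟩; exact S.corner_le_corner_add_side ω i 0 l⟩ k

lemma point_le_corner_add_side (ω : S.Digits) (k : ℕ) (l : Fin d) :
    S.point ω l ≤ S.corner ω k l + S.side k :=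
  ciSup_le fun i => S.corner_le_corner_add_side ω i k l

lemma side_succ_le (k : ℕ) : S.side (k + 1) ≤ S.side k / 2 := by
  have h1 := S.fits k 0
  have h2 := S.side_le_mesh k 0
  have h3 := S.shift_nonneg k 0
  have h4 : (1 : ℝ) ≤ S.count k := by exact_mod_cast S.count_pos k
  have h5 : S.mesh k 0 * 1 ≤ S.mesh k 0 * S.count k := by
    gcongr
    exact (S.mesh_pos k 0).le
  linarith [S.side_pos (k + 1)]

lemma side_antitone : Antitone S.side :=
  antitone_nat_of_succ_le fun k => by linarith [S.side_succ_le k, S.side_pos k]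

lemma tendsto_side : Tendsto S.side atTop (nhds 0) := by
  have hle : ∀ k, S.side k ≤ S.side 0 * (1 / 2) ^ k := by
    intro k
    induction k with
    | zero => simp
    | succ k ih => rw [pow_succ]; linarith [S.side_succ_le k]
  refine squeeze_zero (fun k => (S.side_pos k).le) hle ?_
  simpa using (tendsto_pow_atTop_nhds_zero_of_lt_one (r := (1 / 2 : ℝ))
    (by norm_num) (by norm_num)).const_mul (S.side 0)

lemma corner_congr {ω ω' : S.Digits} {k : ℕ} (h : ∀ j < k, ω j = ω' j) :
    S.corner ω k = S.corner ω' k := by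
  induction k with
  | zero => rfl
  | succ k ih =>
    simp only [corner, ih fun j hj => h j (hj.trans k.lt_succ_self), h k k.lt_succ_self]

lemma dist_corner_point_le (ω : S.Digits) (k : ℕ) :
    dist (S.corner ω k) (S.point ω) ≤ S.side k := by
  refine (dist_pi_le_iff (S.side_pos k).le).2 fun l => ?_
  rw [Real.dist_eq, abs_le]
  constructor <;> linarith [S.corner_le_point ω k l, S.point_le_corner_add_side ω k l]

lemma continuous_point : Continuous S.point := by
  refine continuous_iff_continuousAt.2 fun ω => Metric.tendsto_nhds.2 fun ε hε => ?_
  obtain ⟨k, hk⟩ := (S.tendsto_side.eventually (gt_mem_nhds (half_pos hε))).exists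
  have hev : ∀ᶠ ω' in nhds ω, ∀ j ∈ Finset.range k, ω' j = ω j := by
    refine (Finset.eventually_all _).2 fun j _ => ?_
    exact (continuous_apply j).continuousAt.eventually (by simp : ∀ᶠ c in nhds (ω j), c = ω j)
  filter_upwards [hev] with ω' hω'
  have hc : S.corner ω' k = S.corner ω k :=
    S.corner_congr fun j hj => hω' j (Finset.mem_range.2 hj)
  calc dist (S.point ω') (S.point ω)
      ≤ dist (S.corner ω' k) (S.point ω') + dist (S.corner ω' k) (S.point ω) :=
        dist_triangle_left _ _ _
    _ ≤ S.side k + S.side k := by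
        gcongr
        · exact S.dist_corner_point_le ω' k
        · rw [hc]; exact S.dist_corner_point_le ω k
    _ < ε := by linarith

lemma abs_digit_sub_le {ω ω' : S.Digits} {k : ℕ} {δ : ℝ} (hc : S.corner ω k = S.corner ω' k)
    {l : Fin d} (hδ : |S.point ω l - S.point ω' l| ≤ δ) :
    8 * S.side (k + 1) * |((ω k l : ℕ) : ℝ) - ((ω' k l : ℕ) : ℝ)| ≤ δ + S.side (k + 1) := by
  have hdiff : S.corner ω (k + 1) l - S.corner ω' (k + 1) l =
      S.mesh k (S.corner ω k) * (((ω k l : ℕ) : ℝ) - ((ω' k l : ℕ) : ℝ)) := by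
    simp only [corner, ← hc]
    ring
  have hm := S.mesh_pos k (S.corner ω k)
  calc _ ≤ S.mesh k (S.corner ω k) * |((ω k l : ℕ) : ℝ) - ((ω' k l : ℕ) : ℝ)| := by
        gcongr
        exact S.side_le_mesh k _
    _ = |S.corner ω (k + 1) l - S.corner ω' (k + 1) l| := by
        rw [hdiff, abs_mul, abs_of_pos hm]
    _ ≤ δ + S.side (k + 1) := by
        have h1 := S.corner_le_point ω (k + 1) l
        have h2 := S.corner_le_point ω' (k + 1) l
        have h3 := S.point_le_corner_add_side ω (k + 1) l
        have h4 := S.point_le_corner_add_side ω' (k + 1) l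
        rw [abs_le] at hδ ⊢
        constructor <;> linarith [hδ.1, hδ.2]

lemma digits_eq_of_close {ω ω' : S.Digits} {k : ℕ} {δ : ℝ} (hk : δ < S.side k)
    (hδ : ∀ l, |S.point ω l - S.point ω' l| ≤ δ) : ∀ j < k, ω j = ω' j := by
  intro j
  induction j using Nat.strong_induction_on with
  | _ j ih =>
    intro hj
    have hc : S.corner ω j = S.corner ω' j := S.corner_congr fun i hi => ih i hi (hi.trans hj)
    funext l
    have h1 := S.abs_digit_sub_le hc (hδ l)
    have h2 : S.side k ≤ S.side (j + 1) := S.side_antitone hj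
    have h3 := S.side_pos (j + 1)
    have h4 : |((ω j l : ℕ) : ℝ) - ((ω' j l : ℕ) : ℝ)| < 1 := by
      by_contra! h
      nlinarith
    have h5 : |((ω j l : ℕ) : ℤ) - ((ω' j l : ℕ) : ℤ)| < 1 := by exact_mod_cast h4
    exact Fin.ext (by rw [Int.abs_lt_one_iff] at h5; omega)

/-- The uniform distribution on the branches of the construction. -/
noncomputable def law : Measure S.Digits :=
  Measure.infinitePi fun _ => ProbabilityTheory.uniformOn univ

instance : IsProbabilityMeasure S.law := by
  unfold law
  infer_instance

lemma card_filter_abs_sub_le {n : ℕ} (i : Fin n) {T : ℝ} (hT : 0 ≤ T) :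
    ((Finset.univ.filter fun j : Fin n => |((j : ℕ) : ℝ) - ((i : ℕ) : ℝ)| ≤ T).card : ℝ) ≤
      2 * T + 1 := by
  have hcard : (Finset.univ.filter fun j : Fin n => |((j : ℕ) : ℝ) - ((i : ℕ) : ℝ)| ≤ T).card ≤
      (Finset.Icc ((i : ℤ) - ⌊T⌋) ((i : ℤ) + ⌊T⌋)).card := by
    refine Finset.card_le_card_of_injOn (fun j => ((j : ℕ) : ℤ)) (fun j hj => ?_) ?_
    · have hj' : |((j : ℕ) : ℝ) - ((i : ℕ) : ℝ)| ≤ T := by simpa using hj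
      have : |((j : ℕ) : ℤ) - ((i : ℕ) : ℤ)| ≤ ⌊T⌋ := Int.le_floor.2 (by exact_mod_cast hj')
      rw [abs_le] at this
      simp only [Finset.coe_Icc, Set.mem_Icc]
      constructor <;> linarith [this.1, this.2]
    · intro a _ b _ hab
      exact Fin.ext (by simpa using hab)
  have hfl : 0 ≤ ⌊T⌋ := Int.floor_nonneg.2 hT
  rw [Int.card_Icc] at hcard
  have h2 : ((Finset.univ.filter fun j : Fin n => |((j : ℕ) : ℝ) - ((i : ℕ) : ℝ)| ≤ T).card : ℤ) ≤
      2 * ⌊T⌋ + 1 := by omega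
  have h3 : ((Finset.univ.filter fun j : Fin n => |((j : ℕ) : ℝ) - ((i : ℕ) : ℝ)| ≤ T).card : ℝ) ≤
      2 * ⌊T⌋ + 1 := by exact_mod_cast h2
  linarith [Int.floor_le T]

lemma law_real_pi (k : ℕ) (t : ∀ j, Finset (Fin d → Fin (S.count j))) :
    S.law.real (Set.pi (Finset.range k) fun j => (t j : Set (Fin d → Fin (S.count j)))) =
      ∏ j ∈ Finset.range k, ((t j).card : ℝ) / (S.count j : ℝ) ^ d := by
  rw [measureReal_def, law, Measure.infinitePi_pi _ fun _ _ => MeasurableSet.of_discrete,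
    ENNReal.toReal_prod]
  refine Finset.prod_congr rfl fun j _ => ?_
  rw [ProbabilityTheory.uniformOn_univ, Measure.count_apply_finset]
  simp

lemma law_real_preimage_le {U : Set (Fin d → ℝ)} {k : ℕ} {δ : ℝ} (hδ : S.side (k + 1) ≤ δ)
    (hk : δ < S.side k) (hU : ∀ x ∈ U, ∀ y ∈ U, ∀ l, |x l - y l| ≤ δ) :
    S.law.real (S.point ⁻¹' U) ≤
      ((∏ j ∈ Finset.range k, (S.count j : ℝ)⁻¹) *
        (2 * δ / S.side (k + 1) * (S.count k : ℝ)⁻¹)) ^ d := by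
  have hs := S.side_pos (k + 1)
  have hδ0 : 0 < δ := hs.trans_le hδ
  rcases (S.point ⁻¹' U).eq_empty_or_nonempty with he | ⟨ω₀, hω₀⟩
  · rw [he, measureReal_empty]
    have : 0 ≤ ∏ j ∈ Finset.range k, (S.count j : ℝ)⁻¹ :=
      Finset.prod_nonneg fun _ _ => by positivity
    positivity
  classical
  set T : ℝ := δ / (4 * S.side (k + 1)) with hT
  have hT0 : 0 ≤ T := by positivity
  let B : ∀ j, Finset (Fin d → Fin (S.count j)) := fun j =>
    Fintype.piFinset fun l => Finset.univ.filter fun c =>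
      |((c : ℕ) : ℝ) - ((ω₀ j l : ℕ) : ℝ)| ≤ T
  let t : ∀ j, Finset (Fin d → Fin (S.count j)) := fun j => if j < k then {ω₀ j} else B j
  have hsub : S.point ⁻¹' U ⊆
      Set.pi (Finset.range (k + 1)) fun j => (t j : Set (Fin d → Fin (S.count j))) := by
    intro ω hω j hj
    have hclose := S.digits_eq_of_close hk (hU _ hω _ hω₀)
    by_cases hjk : j < k
    · simp [t, hjk, hclose j hjk]
    · obtain rfl : j = k := by
        have : j < k + 1 := by simpa using hj
        omega
      have hc := S.corner_congr hclose
      simp only [t, lt_irrefl, if_false, B, Finset.mem_coe, Fintype.mem_piFinset,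
        Finset.mem_filter, Finset.mem_univ, true_and]
      intro l
      have h1 := S.abs_digit_sub_le hc (hU _ hω _ hω₀ l)
      rw [hT, le_div_iff₀ (by positivity)]
      linarith
  have hB : ((B k).card : ℝ) ≤ (2 * δ / S.side (k + 1)) ^ d := by
    simp only [B, Fintype.card_piFinset, Nat.cast_prod]
    refine (Finset.prod_le_prod (fun _ _ => Nat.cast_nonneg _)
      (g := fun _ => 2 * δ / S.side (k + 1)) fun l _ => ?_).trans (by simp [div_pow])
    refine (card_filter_abs_sub_le _ hT0).trans ?_
    rw [hT, le_div_iff₀ hs]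
    field_simp
    linarith
  calc S.law.real (S.point ⁻¹' U)
      ≤ S.law.real (Set.pi (Finset.range (k + 1)) fun j =>
          (t j : Set (Fin d → Fin (S.count j)))) := measureReal_mono hsub
    _ = (∏ j ∈ Finset.range k, ((S.count j : ℝ)⁻¹) ^ d) *
          ((B k).card / (S.count k : ℝ) ^ d) := by
        rw [S.law_real_pi, Finset.prod_range_succ]
        congr 1
        · refine Finset.prod_congr rfl fun j hj => ?_
          simp [t, Finset.mem_range.1 hj]
        · simp [t]
    _ ≤ (∏ j ∈ Finset.range k, ((S.count j : ℝ)⁻¹) ^ d) *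
          ((2 * δ / S.side (k + 1)) ^ d / (S.count k : ℝ) ^ d) := by
        gcongr
    _ = _ := by
        rw [Finset.prod_pow, mul_pow, mul_pow, inv_pow _ d, div_eq_mul_inv (_ ^ d)]

/-- If the side lengths satisfy `side (k + 1) ≤ D k`, where `D k` is a scale below which
`(2 * b (k + 2) * t) ^ d ≤ h t`, and the counts lose at most the factor `b` against the side
lengths, then the uniform distribution is dominated by `h`. -/
lemma law_real_preimage_le_gauge {h : ℝ → ℝ} {b D : ℕ → ℝ}
    (hD : ∀ k t, 0 < t → t ≤ D k → (2 * b (k + 2) * t) ^ d ≤ h t)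
    (hside : ∀ k, S.side (k + 1) ≤ D k)
    (hcount : ∀ k, ∏ j ∈ Finset.range k, (S.count j : ℝ)⁻¹ ≤ b k * S.side k)
    {U : Set (Fin d → ℝ)} {δ : ℝ} (hδ0 : 0 < δ) (hδ : δ < S.side 1)
    (hU : ∀ x ∈ U, ∀ y ∈ U, ∀ l, |x l - y l| ≤ δ) :
    S.law.real (S.point ⁻¹' U) ≤ h δ := by
  have hex : ∃ k, S.side k ≤ δ :=
    ((S.tendsto_side.eventually (gt_mem_nhds hδ0)).mono fun _ hk => hk.le).exists
  classical
  obtain ⟨k, hk⟩ : ∃ k, Nat.find hex = k + 2 := by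
    refine Nat.exists_eq_add_of_le' ?_
    by_contra! hlt
    exact absurd ((S.side_antitone (Nat.le_of_lt_succ hlt)).trans (Nat.find_spec hex))
      (not_le.2 hδ)
  have h1 : S.side (k + 1 + 1) ≤ δ := hk ▸ Nat.find_spec hex
  have h2 : δ < S.side (k + 1) := not_le.1 (Nat.find_min hex (by omega))
  have hs := S.side_pos (k + 1 + 1)
  refine (S.law_real_preimage_le h1 h2 hU).trans
    (le_trans ?_ (hD k δ hδ0 (h2.le.trans (hside k))))
  have hc := hcount (k + 1 + 1)
  rw [Finset.prod_range_succ] at hc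
  have hprod : 0 ≤ ∏ j ∈ Finset.range (k + 1), (S.count j : ℝ)⁻¹ :=
    Finset.prod_nonneg fun _ _ => by positivity
  refine pow_le_pow_left₀ (by positivity) ?_ d
  calc _ = ((∏ j ∈ Finset.range (k + 1), (S.count j : ℝ)⁻¹) * (S.count (k + 1) : ℝ)⁻¹) *
        (2 * δ / S.side (k + 1 + 1)) := by ring
    _ ≤ b (k + 1 + 1) * S.side (k + 1 + 1) * (2 * δ / S.side (k + 1 + 1)) := by gcongr
    _ = _ := by field_simp

lemma gaugeMeasure_range_pos {h : ℝ → ℝ} (hdim : IsDimFun h)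
    (hgauge : ∀ (U : Set (Fin d → ℝ)) (δ : ℝ), 0 < δ → δ < S.side 1 →
      (∀ x ∈ U, ∀ y ∈ U, ∀ l, |x l - y l| ≤ δ) → S.law.real (S.point ⁻¹' U) ≤ h δ) :
    0 < gaugeMeasure h (range fun ω => WithLp.toLp 2 (S.point ω) :
      Set (EuclideanSpace ℝ (Fin d))) := by
  set f : S.Digits → EuclideanSpace ℝ (Fin d) := fun ω => WithLp.toLp 2 (S.point ω) with hf
  have hfc : Continuous f := (PiLp.continuous_toLp 2 _).comp S.continuous_point
  have hle : S.law.map f ≤ gaugeMeasure h := by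
    refine Measure.le_mkMetric _ _ (ENNReal.ofReal (S.side 1 / 2))
      (by simpa using S.side_pos 1) fun s hs => ?_
    have hfin : Metric.ediam s ≠ ⊤ := ne_top_of_le_ne_top ENNReal.ofReal_ne_top hs
    set δ₀ := (Metric.ediam s).toReal with hδ₀
    have hδ₀lt : δ₀ < S.side 1 := by
      have := ENNReal.toReal_mono ENNReal.ofReal_ne_top hs
      rw [ENNReal.toReal_ofReal (by linarith [S.side_pos 1])] at this
      linarith [S.side_pos 1]
    have hdist : ∀ x ∈ closure s, ∀ y ∈ closure s, ∀ l, |x l - y l| ≤ δ₀ := by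
      intro x hx y hy l
      have h1 : edist x y ≤ Metric.ediam s := by
        rw [← Metric.ediam_closure]
        exact Metric.edist_le_ediam_of_mem hx hy
      have h2 : dist x y ≤ δ₀ := by
        rw [dist_edist]
        exact ENNReal.toReal_mono hfin h1
      refine le_trans ?_ h2
      rw [dist_eq_norm]
      simpa using PiLp.norm_apply_le (x - y) l
    have hbound : S.law.real (f ⁻¹' closure s) ≤ h δ₀ := by
      have hcont : Tendsto h (nhdsWithin δ₀ (Ioi δ₀)) (nhds (h δ₀)) :=
        (hdim.2.2.2 δ₀ ENNReal.toReal_nonneg).mono Ioi_subset_Ici_self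
      refine ge_of_tendsto hcont ?_
      filter_upwards [Ioo_mem_nhdsGT hδ₀lt] with δ hδ
      refine hgauge (WithLp.toLp 2 ⁻¹' closure s) δ
        (ENNReal.toReal_nonneg.trans_lt hδ.1) hδ.2 fun x hx y hy l => ?_
      exact (hdist _ hx _ hy l).trans hδ.1.le
    calc S.law.map f s ≤ S.law.map f (closure s) := measure_mono subset_closure
      _ = S.law (f ⁻¹' closure s) := Measure.map_apply hfc.measurable isClosed_closure.measurableSet
      _ = ENNReal.ofReal (S.law.real (f ⁻¹' closure s)) := by simp
      _ ≤ ENNReal.ofReal (h δ₀) := ENNReal.ofReal_le_ofReal hbound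
  refine lt_of_lt_of_le ?_ (hle _)
  rw [Measure.map_apply hfc.measurable (isCompact_range hfc).isClosed.measurableSet]
  simp

/-- At a stage whose lattices have spacing `ε`, `ε` (translated by `ε / 2`) and `ε / |β|`
respectively, the relation `x₁ - x₂ = β * (x₃ - x₄)` is destroyed between the branches that use
these lattices. -/
lemma point_sub_ne {k : ℕ} {ε β : ℝ} (hε : 0 < ε) (hβ : β ≠ 0)
    (herr : S.side (k + 1) * (1 + |β|) ≤ ε / 4) {ω₁ ω₂ ω₃ ω₄ : S.Digits}
    (hm₁ : S.mesh k (S.corner ω₁ k) = ε) (hs₁ : S.shift k (S.corner ω₁ k) = ε / 2)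
    (hm₂ : S.mesh k (S.corner ω₂ k) = ε) (hs₂ : S.shift k (S.corner ω₂ k) = 0)
    (hm₃ : S.mesh k (S.corner ω₃ k) = ε / |β|) (hs₃ : S.shift k (S.corner ω₃ k) = 0)
    (hm₄ : S.mesh k (S.corner ω₄ k) = ε / |β|) (hs₄ : S.shift k (S.corner ω₄ k) = 0)
    (l : Fin d) :
    S.point ω₁ l - S.point ω₂ l ≠ β * (S.point ω₃ l - S.point ω₄ l) := by
  intro heq
  have key : ∀ ω : S.Digits, ∃ z : ℤ, ∃ e : ℝ, 0 ≤ e ∧ e ≤ S.side (k + 1) ∧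
      S.point ω l = S.mesh k (S.corner ω k) * z + S.shift k (S.corner ω k) + e := by
    intro ω
    refine ⟨⌈S.corner ω k l / S.mesh k (S.corner ω k)⌉ + (ω k l : ℕ),
      S.point ω l - S.corner ω (k + 1) l, ?_, ?_, ?_⟩
    · linarith [S.corner_le_point ω (k + 1) l]
    · linarith [S.point_le_corner_add_side ω (k + 1) l]
    · simp only [corner]
      push_cast
      ring
  obtain ⟨z₁, e₁, h₁, h₁', he₁⟩ := key ω₁
  obtain ⟨z₂, e₂, h₂, h₂', he₂⟩ := key ω₂
  obtain ⟨z₃, e₃, h₃, h₃', he₃⟩ := key ω₃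
  obtain ⟨z₄, e₄, h₄, h₄', he₄⟩ := key ω₄
  obtain ⟨u, hu⟩ : ∃ u : ℤ, β * (ε / |β|) = ε * u := by
    rcases lt_or_gt_of_ne hβ with hneg | hpos
    · exact ⟨-1, by rw [abs_of_neg hneg]; push_cast; field_simp⟩
    · exact ⟨1, by rw [abs_of_pos hpos]; push_cast; field_simp⟩
  rw [he₁, he₂, he₃, he₄, hm₁, hs₁, hm₂, hs₂, hm₃, hs₃, hm₄, hs₄] at heq
  have hmain : ε * (((2 * (z₁ - z₂ - u * (z₃ - z₄)) + 1 : ℤ) : ℝ) / 2) =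
      β * (e₃ - e₄) - (e₁ - e₂) := by
    push_cast
    linear_combination heq + (z₃ - z₄) * hu
  have hodd : (1 : ℝ) ≤ |((2 * (z₁ - z₂ - u * (z₃ - z₄)) + 1 : ℤ) : ℝ)| := by
    have : (1 : ℤ) ≤ |2 * (z₁ - z₂ - u * (z₃ - z₄)) + 1| :=
      Int.one_le_abs (by omega)
    exact_mod_cast this
  have hlow : ε / 2 ≤ |ε * (((2 * (z₁ - z₂ - u * (z₃ - z₄)) + 1 : ℤ) : ℝ) / 2)| := by
    rw [abs_mul, abs_div, abs_of_pos hε, abs_two]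
    calc ε / 2 = ε * (1 / 2) := by ring
      _ ≤ _ := by gcongr
  have hup : |β * (e₃ - e₄) - (e₁ - e₂)| ≤ S.side (k + 1) * (1 + |β|) := by
    calc |β * (e₃ - e₄) - (e₁ - e₂)| ≤ |β * (e₃ - e₄)| + |e₁ - e₂| := abs_sub _ _
      _ ≤ |β| * S.side (k + 1) + S.side (k + 1) := by
          rw [abs_mul]
          gcongr <;> rw [abs_le] <;> constructor <;> linarith
      _ = _ := by ring
  rw [hmain] at hlow
  linarith

end LatticeScheme

/-- Side lengths decreasing so fast that `side (k + 1)` is at most `D k`. -/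
noncomputable def sideSeq (A D : ℕ → ℝ) : ℕ → ℝ
  | 0 => 1
  | k + 1 => min (D k) (sideSeq A D k / (32 * A k ^ 2))

lemma sideSeq_pos {A D : ℕ → ℝ} (hA : ∀ k, 1 ≤ A k) (hD : ∀ k, 0 < D k) (k : ℕ) :
    0 < sideSeq A D k := by
  induction k with
  | zero => simp [sideSeq]
  | succ k ih =>
    have := zero_lt_one.trans_le (hA k)
    exact lt_min (hD k) (by positivity)

/-- A lattice scheme in which the lattices at stage `k` are prescribed by a function `role`. -/
lemma exists_latticeScheme (d : ℕ) {A β D : ℕ → ℝ} (hβ : ∀ k, β k ≠ 0) (hA : ∀ k, 1 ≤ A k)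
    (hβA : ∀ k, |β k| ≤ A k) (hAβ : ∀ k, |β k|⁻¹ ≤ A k)
    (hD : ∀ k, 0 < D k) (role : ℕ → (Fin d → ℝ) → Fin 3) :
    ∃ (S : LatticeScheme d) (ε : ℕ → ℝ), (∀ k, 0 < ε k) ∧
      (∀ k a, S.mesh k a = if role k a = 2 then ε k / |β k| else ε k) ∧
      (∀ k a, S.shift k a = if role k a = 1 then ε k / 2 else 0) ∧
      (∀ k, S.side (k + 1) * (1 + |β k|) ≤ ε k / 4) ∧
      (∀ k, S.side (k + 1) ≤ D k) ∧
      ∀ k, ∏ j ∈ Finset.range k, (S.count j : ℝ)⁻¹ ≤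
        (∏ j ∈ Finset.range k, 16 * A j ^ 2) * S.side k := by
  set r := sideSeq A D with hr
  have hrpos : ∀ k, 0 < r k := sideSeq_pos hA hD
  have hApos : ∀ k, 0 < A k := fun k => zero_lt_one.trans_le (hA k)
  have hrA : ∀ k, 4 ≤ r k / (8 * A k ^ 2 * r (k + 1)) := by
    intro k
    have h1 : r (k + 1) ≤ r k / (32 * A k ^ 2) := min_le_right _ _
    have := hApos k
    have := hrpos (k + 1)
    rw [le_div_iff₀ (by positivity)] at h1 ⊢
    linarith
  set M : ℕ → ℕ := fun k => ⌊r k / (8 * A k ^ 2 * r (k + 1))⌋₊ - 1 with hM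
  have hMle : ∀ k, (M k : ℝ) + 1 ≤ r k / (8 * A k ^ 2 * r (k + 1)) ∧
      r k / (8 * A k ^ 2 * r (k + 1)) ≤ 2 * M k := by
    intro k
    have h4 : 4 ≤ ⌊r k / (8 * A k ^ 2 * r (k + 1))⌋₊ := Nat.le_floor (by simpa using hrA k)
    have hcast : (M k : ℝ) + 1 = ⌊r k / (8 * A k ^ 2 * r (k + 1))⌋₊ := by
      rw [hM]
      exact_mod_cast Nat.sub_add_cancel (by omega)
    have h5 := Nat.floor_le (zero_le_four.trans (hrA k))
    have h6 := Nat.lt_floor_add_one (r k / (8 * A k ^ 2 * r (k + 1)))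
    constructor <;> linarith [hrA k]
  have hMpos : ∀ k, 0 < M k := by
    intro k
    have : (0 : ℝ) < M k := by linarith [(hMle k).2, hrA k]
    exact_mod_cast this
  set ε : ℕ → ℝ := fun k => 8 * A k * r (k + 1) with hε
  have hεpos : ∀ k, 0 < ε k := fun k => by
    have := hApos k
    have := hrpos (k + 1)
    simp only [hε]
    positivity
  have hmesh : ∀ k a, 8 * r (k + 1) ≤ (if role k a = 2 then ε k / |β k| else ε k) ∧
      (if role k a = 2 then ε k / |β k| else ε k) ≤ ε k * A k := by
    intro k a
    have hb := abs_pos.2 (hβ k)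
    have h1 := hA k
    have h2 := hrpos (k + 1)
    have h3 := hεpos k
    split_ifs
    · constructor
      · rw [le_div_iff₀ hb]
        simp only [hε]
        nlinarith [hβA k]
      · rw [div_eq_mul_inv]
        gcongr
        exact hAβ k
    · constructor
      · simp only [hε]
        nlinarith
      · nlinarith
  have hshift : ∀ k a, 0 ≤ (if role k a = 1 then ε k / 2 else 0) ∧
      (if role k a = 1 then ε k / 2 else 0) ≤ ε k / 2 := by
    intro k a
    have := hεpos k
    split_ifs <;> constructor <;> linarith
  refine ⟨{ side := r
            count := M
            mesh := fun k a => if role k a = 2 then ε k / |β k| else ε k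
            shift := fun k a => if role k a = 1 then ε k / 2 else 0
            side_pos := hrpos
            count_pos := hMpos
            shift_nonneg := fun k a => (hshift k a).1
            side_le_mesh := fun k a => (hmesh k a).1
            fits := fun k a => ?_ }, ε, hεpos, fun _ _ => rfl, fun _ _ => rfl, fun k => ?_,
    fun k => min_le_left _ _, fun k => ?_⟩
  · have h1 := (hmesh k a).2
    have h2 := (hshift k a).2
    have h3 := (hMle k).1
    have h4 := hεpos k
    have h5 := hrpos (k + 1)
    have h6 := hA k
    have h7 : ε k * A k * (M k + 1) ≤ r k := by
      rw [le_div_iff₀ (by positivity)] at h3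
      simp only [hε]
      linarith
    have h8 : (if role k a = 2 then ε k / |β k| else ε k) * (M k : ℝ) ≤ ε k * A k * M k := by
      gcongr
    have h9 : r (k + 1) ≤ ε k / 2 := by
      simp only [hε]
      nlinarith
    have h10 : ε k ≤ ε k * A k := by nlinarith
    linarith
  · have h1 := hβA k
    have h2 := hA k
    have h3 := hrpos (k + 1)
    simp only [hε]
    nlinarith
  · change ∏ j ∈ Finset.range k, (M j : ℝ)⁻¹ ≤ (∏ j ∈ Finset.range k, 16 * A j ^ 2) * r k
    induction k with
    | zero => simp [hr, sideSeq]
    | succ k ih =>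
      rw [Finset.prod_range_succ, Finset.prod_range_succ]
      have hMk : (0 : ℝ) < M k := by exact_mod_cast hMpos k
      have h1 := hApos k
      have h2 := hrpos (k + 1)
      have h3 := hrpos k
      have hinv : (M k : ℝ)⁻¹ ≤ 16 * A k ^ 2 * r (k + 1) / r k := by
        have h4 := (hMle k).2
        rw [div_le_iff₀ (by positivity)] at h4
        rw [inv_le_iff_one_le_mul₀ hMk, div_mul_eq_mul_div, le_div_iff₀ h3]
        linarith
      have hprod : 0 ≤ ∏ j ∈ Finset.range k, 16 * A j ^ 2 :=
        Finset.prod_nonneg fun _ _ => by positivity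
      calc _ ≤ ((∏ j ∈ Finset.range k, 16 * A j ^ 2) * r k) *
            (16 * A k ^ 2 * r (k + 1) / r k) := by gcongr
        _ = _ := by field_simp

lemma Prec.exists_scale {h : ℝ → ℝ} (hdim : IsDimFun h) {d : ℕ}
    (hprec : Prec h fun x : ℝ => x ^ d) {C : ℝ} (hC : 0 ≤ C) :
    ∃ D > 0, ∀ t, 0 < t → t ≤ D → (C * t) ^ d ≤ h t := by
  have hev : ∀ᶠ x in nhdsWithin (0 : ℝ) (Ioi 0), x ^ d / h x < (C ^ d + 1)⁻¹ :=
    hprec.eventually (gt_mem_nhds (by positivity))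
  obtain ⟨D, hD, hsub⟩ := mem_nhdsGT_iff_exists_Ioc_subset.1 hev
  refine ⟨D, hD, fun t ht htD => ?_⟩
  have h1 : t ^ d / h t < (C ^ d + 1)⁻¹ := hsub ⟨ht, htD⟩
  rw [div_lt_iff₀ (hdim.2.1 t ht), ← div_eq_inv_mul, lt_div_iff₀ (by positivity)] at h1
  have : 0 < t ^ d := by positivity
  rw [mul_pow]
  linarith

open Classical in
/-- The role assigned to a point: `1` near `a`, otherwise `2` near `b` or `c`, otherwise `0`. -/
noncomputable def ballRole {X : Type*} [PseudoMetricSpace X] (a b c : X) (ρ : ℝ) (p : X) :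
    Fin 3 :=
  if dist p a < ρ then 1 else if dist p b < ρ ∨ dist p c < ρ then 2 else 0

/-- Countably many role functions suffice to separate all quadruples of distinct points. -/
lemma exists_ballRole_denseSeq {X : Type*} [MetricSpace X] [TopologicalSpace.SeparableSpace X]
    [Nonempty X] {x₁ x₂ x₃ x₄ : X} (h₁₂ : x₁ ≠ x₂) (h₁₃ : x₁ ≠ x₃) (h₁₄ : x₁ ≠ x₄)
    (h₂₃ : x₂ ≠ x₃) (h₂₄ : x₂ ≠ x₄) :
    ∃ i j l m : ℕ, ∃ δ > 0, ∀ p,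
      let R := ballRole (TopologicalSpace.denseSeq X i) (TopologicalSpace.denseSeq X j)
        (TopologicalSpace.denseSeq X l) (1 / ((m : ℝ) + 1)) p
      (dist p x₁ < δ → R = 1) ∧ (dist p x₂ < δ → R = 0) ∧ (dist p x₃ < δ → R = 2) ∧
        (dist p x₄ < δ → R = 2) := by
  have hpos : 0 < min (min (dist x₁ x₂) (dist x₁ x₃))
      (min (dist x₁ x₄) (min (dist x₂ x₃) (dist x₂ x₄))) := by
    simp [*]
  obtain ⟨m, hm⟩ := exists_nat_one_div_lt (half_pos hpos)
  set ρ : ℝ := 1 / ((m : ℝ) + 1) with hρ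
  have hρ0 : 0 < ρ := by positivity
  have hsep : 2 * ρ < dist x₁ x₂ ∧ 2 * ρ < dist x₁ x₃ ∧ 2 * ρ < dist x₁ x₄ ∧
      2 * ρ < dist x₂ x₃ ∧ 2 * ρ < dist x₂ x₄ := by
    have : 2 * ρ < min (min (dist x₁ x₂) (dist x₁ x₃))
      (min (dist x₁ x₄) (min (dist x₂ x₃) (dist x₂ x₄))) := by linarith
    simpa [lt_min_iff, and_assoc] using this
  obtain ⟨hs₁₂, hs₁₃, hs₁₄, hs₂₃, hs₂₄⟩ := hsep
  have hdense : ∀ x : X, ∃ i, dist x (TopologicalSpace.denseSeq X i) < ρ / 2 := fun x =>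
    (TopologicalSpace.denseRange_denseSeq X).exists_dist_lt x (half_pos hρ0)
  obtain ⟨i, hi⟩ := hdense x₁
  obtain ⟨j, hj⟩ := hdense x₃
  obtain ⟨l, hl⟩ := hdense x₄
  have near : ∀ {p x a : X}, dist x a < ρ / 2 → dist p x < ρ / 2 → dist p a < ρ :=
    fun {p x a} h h' => by linarith [dist_triangle p x a]
  have far : ∀ {p x y a : X}, 2 * ρ < dist x y → dist x a < ρ / 2 → dist p y < ρ / 2 →
      ¬ dist p a < ρ := fun {p x y a} h h' h'' h3 => by
    have h4 := dist_triangle4 x a p y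
    rw [dist_comm a p] at h4
    linarith
  refine ⟨i, j, l, m, ρ / 2, half_pos hρ0, fun p => ?_⟩
  simp only [← hρ]
  clear_value ρ
  refine ⟨fun hp => ?_, fun hp => ?_, fun hp => ?_, fun hp => ?_⟩
  · simp [ballRole, near hi hp]
  · have h1 := far hs₁₂ hi hp
    have h2 := far (by rwa [dist_comm]) hj hp
    have h3 := far (by rwa [dist_comm]) hl hp
    simp [ballRole, h1, h2, h3]
  · simp [ballRole, far hs₁₃ hi hp, near hj hp]
  · simp [ballRole, far hs₁₄ hi hp, near hl hp]

theorem stmt_18 (d : ℕ) (hd : 0 < d) (h : ℝ → ℝ) (hdim : IsDimFun h)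
    (hprec : Prec h (fun x : ℝ => x ^ d))
    (α : ℕ → ℝ) (hα : ∀ n, α n ≠ 0) :
    ∃ E : Set (EuclideanSpace ℝ (Fin d)), IsCompact E ∧ 0 < gaugeMeasure h E ∧
      ∀ n, ∀ x₁ ∈ E, ∀ x₂ ∈ E, ∀ x₃ ∈ E, ∀ x₄ ∈ E,
        x₁ ≠ x₂ → x₁ ≠ x₃ → x₁ ≠ x₄ → x₂ ≠ x₃ → x₂ ≠ x₄ → x₃ ≠ x₄ →
          x₁ - x₂ ≠ α n • (x₃ - x₄) := by
  obtain ⟨task, htask⟩ := exists_surjective_nat (ℕ × ℕ × ℕ × ℕ × ℕ)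
  let τ : ℕ → ℕ × ℕ × ℕ × ℕ × ℕ := fun k => task k.unpair.1
  let q := TopologicalSpace.denseSeq (Fin d → ℝ)
  let role : ℕ → (Fin d → ℝ) → Fin 3 := fun k =>
    ballRole (q (τ k).2.1) (q (τ k).2.2.1) (q (τ k).2.2.2.1) (1 / (((τ k).2.2.2.2 : ℝ) + 1))
  let β : ℕ → ℝ := fun k => α (τ k).1
  let A : ℕ → ℝ := fun k => max |β k| |β k|⁻¹
  let b : ℕ → ℝ := fun k => ∏ j ∈ Finset.range k, 16 * A j ^ 2
  have hβ : ∀ k, β k ≠ 0 := fun k => hα _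
  have hA : ∀ k, 1 ≤ A k := fun k => by
    rcases le_total 1 |β k| with h1 | h1
    · exact le_max_of_le_left h1
    · exact le_max_of_le_right ((one_le_inv₀ (abs_pos.2 (hβ k))).2 h1)
  have hb : ∀ k, 0 ≤ b k := fun k => Finset.prod_nonneg fun _ _ => by positivity
  choose D hD hDh using fun k =>
    hprec.exists_scale hdim (C := 2 * b (k + 2)) (by linarith [hb (k + 2)])
  obtain ⟨S, ε, hε, hmesh, hshift, herr, hside, hcount⟩ :=
    exists_latticeScheme d hβ hA (fun k => le_max_left _ _) (fun k => le_max_right _ _) hD role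
  refine ⟨range fun ω => WithLp.toLp 2 (S.point ω),
    isCompact_range ((PiLp.continuous_toLp 2 _).comp S.continuous_point),
    S.gaugeMeasure_range_pos hdim fun U δ h0 h1 hU =>
      S.law_real_preimage_le_gauge (b := b) hDh hside hcount h0 h1 hU, ?_⟩
  rintro n _ ⟨ω₁, rfl⟩ _ ⟨ω₂, rfl⟩ _ ⟨ω₃, rfl⟩ _ ⟨ω₄, rfl⟩ h₁₂ h₁₃ h₁₄ h₂₃ h₂₄ - heq
  obtain ⟨i, j, l, m, δ, hδ, hR⟩ := exists_ballRole_denseSeq (ne_of_apply_ne _ h₁₂)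
    (ne_of_apply_ne _ h₁₃) (ne_of_apply_ne _ h₁₄) (ne_of_apply_ne _ h₂₃) (ne_of_apply_ne _ h₂₄)
  obtain ⟨t, ht⟩ := htask (n, i, j, l, m)
  obtain ⟨K, hK⟩ := (S.tendsto_side.eventually (gt_mem_nhds hδ)).exists
  set k := Nat.pair t K with hk
  have hτ : τ k = (n, i, j, l, m) := by simp [τ, hk, ht]
  have hnear : ∀ ω, dist (S.corner ω k) (S.point ω) < δ := fun ω =>
    (S.dist_corner_point_le ω k).trans_lt
      ((S.side_antitone (Nat.right_le_pair t K)).trans_lt hK)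
  have hrole : role k = ballRole (q i) (q j) (q l) (1 / ((m : ℝ) + 1)) := by
    simp only [role, hτ]
  have hr₁ : role k (S.corner ω₁ k) = 1 := by rw [hrole]; exact (hR _).1 (hnear ω₁)
  have hr₂ : role k (S.corner ω₂ k) = 0 := by rw [hrole]; exact (hR _).2.1 (hnear ω₂)
  have hr₃ : role k (S.corner ω₃ k) = 2 := by rw [hrole]; exact (hR _).2.2.1 (hnear ω₃)
  have hr₄ : role k (S.corner ω₄ k) = 2 := by rw [hrole]; exact (hR _).2.2.2 (hnear ω₄)
  refine S.point_sub_ne (hε k) (hβ k) (herr k) (ω₁ := ω₁) (ω₂ := ω₂) (ω₃ := ω₃) (ω₄ := ω₄)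
    (by simp [hmesh, hr₁]) (by simp [hshift, hr₁]) (by simp [hmesh, hr₂])
    (by simp [hshift, hr₂]) (by simp [hmesh, hr₃]) (by simp [hshift, hr₃])
    (by simp [hmesh, hr₄]) (by simp [hshift, hr₄]) ⟨0, hd⟩ ?_
  have hβn : β k = α n := by simp only [β, hτ]
  rw [hβn]
  simpa using congrArg (fun v : EuclideanSpace ℝ (Fin d) => v ⟨0, hd⟩) heq
end

section
/- Let h be a dimension function with h ≺ x², and let (x_n, y_n, z_n)_{n∈ℕ} be a sequence of triplets of pairwise distinct complex numbers. Then there exists a compact set E ⊆ ℂ with ℋ^h(E) > 0 that contains no (direct) similar copy of any of the given triplets: there are no distinct a, b, c ∈ E and w ∈ ℂ \ {0}, t ∈ ℂ with a = w·x_n + t, b = w·y_n + t, c = w·z_n + t for some n. -/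
open MeasureTheory Filter Set

theorem integrable_mul_comp_inner {V : Type*} [NormedAddCommGroup V] [InnerProductSpace ℝ V]
    [MeasurableSpace V] [BorelSpace V] [FiniteDimensional ℝ V]
    {f : V → ℂ} (hf : Integrable f) (β : V) (g : C(UnitAddCircle, ℂ)) (N : ℕ) :
    Integrable fun v => f v * g ((N * inner ℝ v β : ℝ) : UnitAddCircle) := by
  refine hf.mul_bdd (c := ‖g‖) ?_ (ae_of_all _ fun v => g.norm_coe_le_norm _)
  refine Continuous.aestronglyMeasurable ?_
  refine g.continuous.comp ((AddCircle.continuous_mk' (1 : ℝ)).comp ?_)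
  fun_prop

open AddCircle in
/-- Riemann-Lebesgue lemma for periodic functions: `v ↦ g (N * ⟪v, β⟫)` converges weakly to the
mean of `g` as `N → ∞`. -/
theorem tendsto_integral_mul_comp_inner {V : Type*} [NormedAddCommGroup V] [InnerProductSpace ℝ V]
    [MeasurableSpace V] [BorelSpace V] [FiniteDimensional ℝ V]
    {f : V → ℂ} (hf : Integrable f) {β : V} (hβ : β ≠ 0) (g : C(UnitAddCircle, ℂ)) :
    Tendsto (fun N : ℕ => ∫ v, f v * g ((N * inner ℝ v β : ℝ) : UnitAddCircle)) atTop
      (nhds ((∫ v, f v) * ∫ t, g t ∂haarAddCircle)) := by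
  have hint (g : C(UnitAddCircle, ℂ)) : Integrable g haarAddCircle :=
    g.continuous.integrable_of_hasCompactSupport (HasCompactSupport.of_compactSpace _)
  have hspan : ∀ g ∈ Submodule.span ℂ (range (fourier (T := (1 : ℝ)))),
      Tendsto (fun N : ℕ => ∫ v, f v * g ((N * inner ℝ v β : ℝ) : UnitAddCircle)) atTop
        (nhds ((∫ v, f v) * ∫ t, g t ∂haarAddCircle)) := by
    intro g hg
    induction hg using Submodule.span_induction with
    | mem g hg =>
      obtain ⟨n, rfl⟩ := hg
      rcases eq_or_ne n 0 with rfl | hn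
      · simp
      · have h0 : ∫ t : UnitAddCircle, fourier n t ∂haarAddCircle = 0 :=
          integral_eq_zero_of_add_right_eq_neg (μ := haarAddCircle)
            (fourier_add_half_inv_index hn one_pos)
        rw [h0, mul_zero]
        have hw : Tendsto (fun N : ℕ => (N : ℝ) • ((-n : ℝ) • β)) atTop (cocompact V) := by
          rw [← Metric.cobounded_eq_cocompact, ← tendsto_norm_atTop_iff_cobounded]
          simp_rw [norm_smul, Real.norm_natCast]
          refine Tendsto.atTop_mul_const ?_ tendsto_natCast_atTop_atTop
          have : (n : ℝ) ≠ 0 := by exact_mod_cast hn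
          have := norm_pos_iff.2 this
          have := norm_pos_iff.2 hβ
          rw [norm_neg]
          positivity
        refine ((tendsto_integral_exp_inner_smul_cocompact f).comp hw).congr fun N => ?_
        refine integral_congr_ae (ae_of_all _ fun v => ?_)
        simp only
        rw [fourier_coe_apply, Circle.smul_def, Real.fourierChar_apply, smul_eq_mul, mul_comm]
        simp only [inner_smul_right]
        congr 2
        push_cast
        ring
    | zero => simp
    | add g₁ g₂ _ _ h₁ h₂ =>
      convert! h₁.add h₂ using 2 with N
      · rw [← integral_add (integrable_mul_comp_inner hf β g₁ N)
          (integrable_mul_comp_inner hf β g₂ N)]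
        simp [mul_add]
      · rw [← mul_add, ← integral_add (hint g₁) (hint g₂)]
        simp
    | smul a g _ h =>
      convert! h.const_mul a using 2 with N
      · rw [← integral_const_mul]
        congr 1 with v
        simp; ring
      · simp only [ContinuousMap.smul_apply, smul_eq_mul, integral_const_mul]
        ring
  have hI : 0 ≤ ∫ v, ‖f v‖ := integral_nonneg fun _ => norm_nonneg _
  set I := ∫ v, ‖f v‖
  rw [Metric.tendsto_atTop]
  intro ε hε
  have hmem : g ∈ closure (Submodule.span ℂ (range (fourier (T := (1 : ℝ)))) : Set _) := by
    rw [← Submodule.topologicalClosure_coe, span_fourier_closure_eq_top]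
    trivial
  obtain ⟨g', hg', hd⟩ := Metric.mem_closure_iff.1 hmem (ε / (3 * (I + 1))) (by positivity)
  rw [dist_eq_norm] at hd
  have hsmall : I * ‖g - g'‖ ≤ ε / 3 := by
    calc I * ‖g - g'‖ ≤ (I + 1) * (ε / (3 * (I + 1))) := by gcongr; linarith
      _ = ε / 3 := by field_simp
  obtain ⟨N₀, hN₀⟩ := Metric.tendsto_atTop.1 (hspan g' hg') (ε / 3) (by positivity)
  refine ⟨N₀, fun N hN => ?_⟩
  have h1 : dist (∫ v, f v * g ((N * inner ℝ v β : ℝ) : UnitAddCircle))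
      (∫ v, f v * g' ((N * inner ℝ v β : ℝ) : UnitAddCircle)) ≤ ε / 3 := by
    rw [dist_eq_norm, ← integral_sub (integrable_mul_comp_inner hf β g N)
      (integrable_mul_comp_inner hf β g' N)]
    refine le_trans ?_ hsmall
    rw [← integral_mul_const]
    refine norm_integral_le_of_norm_le (hf.norm.mul_const _) (ae_of_all _ fun v => ?_)
    rw [← mul_sub, norm_mul]
    gcongr
    exact (g - g').norm_coe_le_norm _
  have h2 : dist ((∫ v, f v) * ∫ t, g' t ∂haarAddCircle)
      ((∫ v, f v) * ∫ t, g t ∂haarAddCircle) ≤ ε / 3 := by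
    rw [dist_comm, dist_eq_norm, ← mul_sub, ← integral_sub (hint g) (hint g'), norm_mul]
    refine le_trans ?_ hsmall
    gcongr
    · exact norm_integral_le_integral_norm _
    · simpa using norm_integral_le_of_norm_le_const (μ := haarAddCircle)
        (ae_of_all _ fun t => (g - g').norm_coe_le_norm t)
  have h3 := hN₀ N hN
  calc _ ≤ _ := dist_triangle4 _ (∫ v, f v * g' ((N * inner ℝ v β : ℝ) : UnitAddCircle))
        ((∫ v, f v) * ∫ t, g' t ∂haarAddCircle) _
    _ < ε := by linarith

open AddCircle in
/-- A nonnegative bump with mean one on the circle, supported near `s`. -/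
theorem exists_bump (s : UnitAddCircle) :
    ∃ g : C(UnitAddCircle, ℝ), (∀ t, 0 ≤ g t) ∧ (∫ t, g t ∂haarAddCircle = 1) ∧
      ∀ t, g t ≠ 0 → ‖t - s‖ ≤ 1 / 12 := by
  obtain ⟨g₀, hg₀⟩ : ∃ g₀ : C(UnitAddCircle, ℝ), ∀ t, g₀ t = max 0 (1 / 12 - ‖t - s‖) :=
    ⟨⟨fun t => max 0 (1 / 12 - ‖t - s‖), by fun_prop⟩, fun _ => rfl⟩
  have hnn : ∀ t, 0 ≤ g₀ t := fun t => hg₀ t ▸ le_max_left _ _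
  have hpos : 0 < ∫ t, g₀ t ∂haarAddCircle :=
    g₀.continuous.integral_pos_of_hasCompactSupport_nonneg_nonzero
      (HasCompactSupport.of_compactSpace _) hnn (x := s) (by simp [hg₀])
  refine ⟨(∫ t, g₀ t ∂haarAddCircle)⁻¹ • g₀, fun t => ?_, ?_, fun t ht => ?_⟩
  · exact mul_nonneg (inv_nonneg.2 hpos.le) (hnn t)
  · simp only [ContinuousMap.smul_apply, smul_eq_mul, integral_const_mul]
    exact inv_mul_cancel₀ hpos.ne'
  · by_contra! hlt
    refine ht ?_
    have : g₀ t = 0 := (hg₀ t).trans (max_eq_left (by linarith))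
    simp [this]

section weights

variable {V : Type*} [NormedAddCommGroup V] [InnerProductSpace ℝ V]
    [MeasurableSpace V] [BorelSpace V] [FiniteDimensional ℝ V]

open AddCircle in
theorem tendsto_integral_indicator_mul_sub {f : V → ℝ} (hf : Integrable f) {A : Set V}
    (hA : MeasurableSet A) {β : V} (hβ : β ≠ 0) {g : C(UnitAddCircle, ℝ)}
    (hg : ∫ t, g t ∂haarAddCircle = 1) :
    Tendsto (fun N : ℕ => ∫ v, f v *
      A.indicator (fun v => g ((N * inner ℝ v β : ℝ) : UnitAddCircle) - 1) v) atTop (nhds 0) := by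
  have hfA : Integrable (A.indicator f) := hf.indicator hA
  have hfA' : Integrable (fun v => ((A.indicator f v : ℝ) : ℂ)) := hfA.ofReal
  let G : C(UnitAddCircle, ℂ) := ⟨fun t => (g t : ℂ), by fun_prop⟩
  have key := tendsto_integral_mul_comp_inner hfA' hβ G
  have hG : ∫ t, G t ∂haarAddCircle = 1 := by
    change ∫ t, ((g t : ℝ) : ℂ) ∂haarAddCircle = 1
    rw [integral_complex_ofReal, hg, Complex.ofReal_one]
  rw [hG, mul_one] at key
  have key' := (Complex.continuous_re.tendsto _).comp
    (key.sub_const (∫ v, ((A.indicator f v : ℝ) : ℂ)))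
  rw [sub_self, Complex.zero_re] at key'
  refine key'.congr fun N => ?_
  rw [Function.comp_apply, ← integral_sub (integrable_mul_comp_inner hfA' β G N) hfA',
    ← Complex.ofReal_re (∫ v, f v * _), ← integral_complex_ofReal]
  congr 2 with v
  by_cases hv : v ∈ A <;> simp [hv, G, mul_sub]

open AddCircle in
/-- There is `M` such that for any pairwise disjoint open sets `A, B, C`, weights `w ≤ M` arbitrarily
weakly close to `1` can be found that vanish off a closed set `F` containing no solution
`(a, b, c) ∈ A × B × C` of `⟪a, β₁⟫ - ⟪b, β₂⟫ + ⟪c, β₃⟫ = 0`. -/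
theorem exists_weight (V : Type*) [NormedAddCommGroup V] [InnerProductSpace ℝ V]
    [MeasurableSpace V] [BorelSpace V] [FiniteDimensional ℝ V] :
    ∃ M : ℝ, 1 ≤ M ∧ ∀ (A B C : Set V), IsOpen A → IsOpen B → IsOpen C → Disjoint A B →
      Disjoint B C → Disjoint A C → ∀ β₁ β₂ β₃ : V, β₁ ≠ 0 → β₂ ≠ 0 → β₃ ≠ 0 →
      ∀ T : Set (V → ℝ), T.Finite → (∀ f ∈ T, Integrable f) → ∀ ε > 0,
      ∃ (w : V → ℝ) (F : Set V), IsClosed F ∧ Measurable w ∧ (∀ v, 0 ≤ w v ∧ w v ≤ M) ∧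
        (∀ v ∉ F, w v = 0) ∧ (∀ f ∈ T, |(∫ v, f v * w v) - ∫ v, f v| ≤ ε) ∧
        ∀ a ∈ A ∩ F, ∀ b ∈ B ∩ F, ∀ c ∈ C ∩ F,
          inner ℝ a β₁ - inner ℝ b β₂ + inner ℝ c β₃ ≠ 0 := by
  obtain ⟨g₁, hg₁, hm₁, hs₁⟩ := exists_bump ((1 / 2 : ℝ) : UnitAddCircle)
  obtain ⟨g₂, hg₂, hm₂, hs₂⟩ := exists_bump 0
  refine ⟨1 + ‖g₁‖ + ‖g₂‖, by linarith [norm_nonneg g₁, norm_nonneg g₂], ?_⟩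
  intro A B C hA hB hC hAB hBC hAC β₁ β₂ β₃ hβ₁ hβ₂ hβ₃ T hT hTi ε hε
  let u (g : C(UnitAddCircle, ℝ)) (β : V) (N : ℕ) (v : V) : ℝ :=
    g ((N * inner ℝ v β : ℝ) : UnitAddCircle)
  have hucont (g β N) : Continuous (u g β N) :=
    g.continuous.comp ((AddCircle.continuous_mk' (1 : ℝ)).comp (by fun_prop))
  have hule (g β N v) : u g β N v ≤ ‖g‖ := (le_abs_self _).trans (g.norm_coe_le_norm _)
  let i (D : Set V) (g : C(UnitAddCircle, ℝ)) (β : V) (N : ℕ) : V → ℝ :=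
    D.indicator (fun v => u g β N v - 1)
  have himeas {D : Set V} (hD : IsOpen D) (g β N) : Measurable (i D g β N) :=
    ((hucont g β N).measurable.sub_const _).indicator hD.measurableSet
  have hint {f : V → ℝ} (hf : Integrable f) {D : Set V} (hD : IsOpen D) (g β N) :
      Integrable (fun v => f v * i D g β N v) := by
    refine hf.mul_bdd (c := ‖g‖ + 1) (himeas hD g β N).aestronglyMeasurable
      (ae_of_all _ fun v => ?_)
    refine (norm_indicator_le_norm_self _ _).trans ((norm_sub_le _ _).trans ?_)
    rw [norm_one]
    gcongr
    exact g.norm_coe_le_norm _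
  let w (N : ℕ) (v : V) : ℝ := 1 + i A g₁ β₁ N v + i B g₂ β₂ N v + i C g₂ β₃ N v
  have hlim : ∀ f ∈ T, ∀ᶠ N in atTop, |(∫ v, f v * w N v) - ∫ v, f v| ≤ ε := by
    intro f hfT
    have hf := hTi f hfT
    have := ((tendsto_integral_indicator_mul_sub hf hA.measurableSet hβ₁ hm₁).add
      (tendsto_integral_indicator_mul_sub hf hB.measurableSet hβ₂ hm₂)).add
      (tendsto_integral_indicator_mul_sub hf hC.measurableSet hβ₃ hm₂)
    simp only [add_zero] at this
    filter_upwards [this.eventually (Metric.closedBall_mem_nhds _ hε)] with N hN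
    rw [dist_zero_right, Real.norm_eq_abs] at hN
    convert! hN using 2
    have e : ∀ v, f v * w N v =
        f v + f v * i A g₁ β₁ N v + f v * i B g₂ β₂ N v + f v * i C g₂ β₃ N v := fun v => by
      simp only [w]; ring
    simp_rw [e]
    rw [integral_add _ (hint hf hC _ _ _), integral_add _ (hint hf hB _ _ _),
      integral_add hf (hint hf hA _ _ _)]
    · ring
    · exact hf.add (hint hf hA _ _ _)
    · exact (hf.add (hint hf hA _ _ _)).add (hint hf hB _ _ _)
  obtain ⟨N, hN⟩ := ((eventually_all_finite hT).2 hlim).exists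
  let q (β v : V) : UnitAddCircle := ((N * inner ℝ v β : ℝ) : UnitAddCircle)
  have hq (β : V) : Continuous (q β) :=
    (AddCircle.continuous_mk' (1 : ℝ)).comp (by fun_prop)
  let F : Set V := {v | v ∈ A → ‖q β₁ v - ((1 / 2 : ℝ) : UnitAddCircle)‖ ≤ 1 / 12} ∩
    ({v | v ∈ B → ‖q β₂ v - 0‖ ≤ 1 / 12} ∩ {v | v ∈ C → ‖q β₃ v - 0‖ ≤ 1 / 12})
  have hclosed (D : Set V) (hD : IsOpen D) (β : V) (s : UnitAddCircle) :
      IsClosed {v | v ∈ D → ‖q β v - s‖ ≤ 1 / 12} :=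
    isClosed_imp hD (isClosed_le ((hq β).sub continuous_const).norm continuous_const)
  have hwA : ∀ v ∈ A, w N v = u g₁ β₁ N v := fun v hv => by
    have h₁ := hAB.notMem_of_mem_left hv
    have h₂ := hAC.notMem_of_mem_left hv
    simp [w, i, hv, h₁, h₂]
  have hwB : ∀ v ∈ B, w N v = u g₂ β₂ N v := fun v hv => by
    have h₁ := hAB.notMem_of_mem_right hv
    have h₂ := hBC.notMem_of_mem_left hv
    simp [w, i, hv, h₁, h₂]
  have hwC : ∀ v ∈ C, w N v = u g₂ β₃ N v := fun v hv => by
    have h₁ := hAC.notMem_of_mem_right hv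
    have h₂ := hBC.notMem_of_mem_right hv
    simp [w, i, hv, h₁, h₂]
  refine ⟨w N, F, (hclosed A hA _ _).inter ((hclosed B hB _ _).inter (hclosed C hC _ _)),
    ((measurable_const.add (himeas hA _ _ _)).add (himeas hB _ _ _)).add (himeas hC _ _ _),
    fun v => ?_, fun v hv => ?_, hN, ?_⟩
  · have := norm_nonneg g₁
    have := norm_nonneg g₂
    by_cases hvA : v ∈ A
    · rw [hwA v hvA]
      exact ⟨hg₁ _, (hule _ _ _ _).trans (by linarith)⟩
    by_cases hvB : v ∈ B
    · rw [hwB v hvB]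
      exact ⟨hg₂ _, (hule _ _ _ _).trans (by linarith)⟩
    by_cases hvC : v ∈ C
    · rw [hwC v hvC]
      exact ⟨hg₂ _, (hule _ _ _ _).trans (by linarith)⟩
    have : w N v = 1 := by simp [w, i, hvA, hvB, hvC]
    rw [this]
    exact ⟨zero_le_one, by linarith⟩
  · by_contra hw
    refine hv ⟨fun hvA => hs₁ _ ?_, fun hvB => hs₂ _ ?_, fun hvC => hs₂ _ ?_⟩
    · rwa [hwA v hvA] at hw
    · rwa [hwB v hvB] at hw
    · rwa [hwC v hvC] at hw
  · rintro a ⟨haA, haF⟩ b ⟨hbB, hbF⟩ c ⟨hcC, hcF⟩ h0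
    have ha := haF.1 haA
    have hb := hbF.2.1 hbB
    have hc := hcF.2.2 hcC
    rw [sub_zero] at hb hc
    have hsum : q β₁ a - q β₂ b + q β₃ c = 0 := by
      simp only [q, ← AddCircle.coe_sub, ← AddCircle.coe_add, ← mul_sub, ← mul_add, h0, mul_zero,
        AddCircle.coe_zero]
    have hhalf : ‖((1 / 2 : ℝ) : UnitAddCircle)‖ = 1 / 2 := by
      simpa using AddCircle.norm_half_period_eq (1 : ℝ)
    have : ((1 / 2 : ℝ) : UnitAddCircle) =
        q β₂ b - q β₃ c - (q β₁ a - ((1 / 2 : ℝ) : UnitAddCircle)) := by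
      rw [← sub_eq_zero, ← hsum]; abel
    have h₁ := norm_sub_le (q β₂ b - q β₃ c) (q β₁ a - ((1 / 2 : ℝ) : UnitAddCircle))
    have h₂ := norm_sub_le (q β₂ b) (q β₃ c)
    rw [← this, hhalf] at h₁
    linarith

end weights

open scoped ENNReal NNReal

/-- Mass distribution principle along a decreasing sequence of compact sets. -/
theorem le_gaugeMeasure_iInter {X : Type*} [MetricSpace X] [MeasurableSpace X] [BorelSpace X]
    {h : ℝ → ℝ} (hdim : IsDimFun h) {E : ℕ → Set X} (hE : Antitone E)
    (hc : ∀ k, IsCompact (E k)) {ν : ℕ → Measure X} {c : ℝ≥0∞} (hν : ∀ k, c ≤ ν k (E k))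
    {r : ℝ} (hr : 0 < r)
    (hball : ∀ k x ρ, 0 < ρ → ρ ≤ r → ν k (Metric.ball x ρ) ≤ ENNReal.ofReal (h ρ)) :
    c ≤ gaugeMeasure h (⋂ k, E k) := by
  rw [gaugeMeasure, Measure.mkMetric_apply]
  refine le_iSup₂_of_le (ENNReal.ofReal (r / 2)) (by simpa using hr)
    (le_iInf₂ fun t ht => le_iInf fun hd => ?_)
  refine ENNReal.le_of_forall_pos_le_add fun ε hε _ => ?_
  obtain ⟨ε', hε', hsum⟩ :=
    ENNReal.exists_pos_sum_of_countable (ENNReal.coe_pos.2 hε).ne' ℕ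
  have hU : ∀ n, ∃ U : Set X, IsOpen U ∧ t n ⊆ U ∧ ∀ k, ν k U ≤
      (⨆ _ : (t n).Nonempty, ENNReal.ofReal (h (Metric.ediam (t n)).toReal)) + ε' n := by
    intro n
    rcases (t n).eq_empty_or_nonempty with he | hne
    · exact ⟨∅, isOpen_empty, he.subset, by simp⟩
    obtain ⟨x, hx⟩ := hne
    have hfin : Metric.ediam (t n) ≠ ∞ := ne_top_of_le_ne_top ENNReal.ofReal_ne_top (hd n)
    set d := (Metric.ediam (t n)).toReal with hd_def
    have hd0 : 0 ≤ d := ENNReal.toReal_nonneg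
    have hdr : d < r := by
      have := ENNReal.toReal_mono ENNReal.ofReal_ne_top (hd n)
      rw [ENNReal.toReal_ofReal (by positivity)] at this
      linarith
    have hcont : Tendsto h (nhdsWithin d (Ioi d)) (nhds (h d)) :=
      (hdim.2.2.2 d hd0).mono_left (nhdsWithin_mono _ Ioi_subset_Ici_self)
    have hlt : ∀ᶠ ρ in nhdsWithin d (Ioi d), h ρ < h d + ε' n :=
      hcont.eventually_lt_const (by simpa using hε' n)
    obtain ⟨ρ, hρ, hdρ, hρr⟩ := (hlt.and (Ioo_mem_nhdsGT hdr)).exists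
    refine ⟨Metric.ball x ρ, Metric.isOpen_ball, fun y hy => ?_, fun k => ?_⟩
    · rw [Metric.mem_ball, dist_edist]
      exact (ENNReal.toReal_mono hfin (Metric.edist_le_ediam_of_mem hy hx)).trans_lt hdρ
    · refine (hball k x ρ (hd0.trans_lt hdρ) hρr.le).trans ?_
      rw [iSup_pos ⟨x, hx⟩]
      refine (ENNReal.ofReal_le_ofReal hρ.le).trans (ENNReal.ofReal_add_le.trans ?_)
      rw [ENNReal.ofReal_coe_nnreal]
  choose U hUo htU hνU using hU
  obtain ⟨k, hk⟩ : ∃ k, E k ⊆ ⋃ n, U n :=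
    exists_subset_nhds_of_isCompact' (hE.directed_ge) hc (fun k => (hc k).isClosed)
      fun x hx => (isOpen_iUnion hUo).mem_nhds (iUnion_mono htU (ht hx))
  calc c ≤ ν k (⋃ n, U n) := (hν k).trans (measure_mono hk)
    _ ≤ ∑' n, ν k (U n) := measure_iUnion_le _
    _ ≤ ∑' n, ((⨆ _ : (t n).Nonempty, ENNReal.ofReal (h (Metric.ediam (t n)).toReal)) + ε' n) :=
      ENNReal.tsum_le_tsum fun n => hνU n k
    _ ≤ _ := by
      rw [ENNReal.tsum_add]
      gcongr

theorem Prec.exists_scales {h : ℝ → ℝ} (hdim : IsDimFun h) (hprec : Prec h (fun x : ℝ => x ^ 2))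
    (c : ℕ → ℝ) (hc : ∀ k, 0 < c k) :
    ∃ J : ℕ → ℕ, StrictMono J ∧
      ∀ k t, 0 < t → t ≤ (1 / 2 : ℝ) ^ J k → c k * t ^ 2 ≤ h t := by
  refine extraction_forall_of_eventually' (P := fun k j => ∀ t, 0 < t → t ≤ (1 / 2 : ℝ) ^ j →
    c k * t ^ 2 ≤ h t) fun k => ?_
  have h1 : ∀ᶠ t in nhdsWithin (0 : ℝ) (Ioi 0), t ^ 2 / h t < (c k)⁻¹ :=
    hprec.eventually_lt_const (inv_pos.2 (hc k))
  obtain ⟨δ, hδ, hsub⟩ := mem_nhdsGT_iff_exists_Ioo_subset.1 h1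
  obtain ⟨N, hN⟩ := exists_pow_lt_of_lt_one hδ (by norm_num : (1 / 2 : ℝ) < 1)
  refine ⟨N, fun j hj t ht htj => ?_⟩
  have hlt : t < δ := (htj.trans (pow_le_pow_of_le_one (by norm_num) (by norm_num) hj)).trans_lt hN
  have h2 : t ^ 2 / h t < (c k)⁻¹ := hsub ⟨ht, hlt⟩
  rw [div_lt_iff₀ (hdim.2.1 t ht), inv_mul_eq_div, lt_div_iff₀ (hc k)] at h2
  linarith

/-- Iterating weights weakly close to `1` on prescribed test sets. -/
theorem exists_densities {X : Type*} [MeasurableSpace X] [TopologicalSpace X] {μ : Measure X}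
    {P : ℕ → Set X → Prop} {M : ℝ} (hM : 1 ≤ M)
    (H : ∀ i, ∀ T : Set (X → ℝ), T.Finite → (∀ f ∈ T, Integrable f μ) → ∀ ε > 0,
      ∃ (w : X → ℝ) (F : Set X), IsClosed F ∧ Measurable w ∧ (∀ v, 0 ≤ w v ∧ w v ≤ M) ∧
        (∀ v ∉ F, w v = 0) ∧ (∀ f ∈ T, |(∫ v, f v * w v ∂μ) - ∫ v, f v ∂μ| ≤ ε) ∧ P i F)
    (S : ℕ → Set (Set X)) (hS : ∀ k, (S k).Finite) (hSm : ∀ k, ∀ s ∈ S k, MeasurableSet s)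
    (ε : ℕ → ℝ) (hε : ∀ k, 0 < ε k) {f₀ : X → ℝ} (hf₀ : Integrable f₀ μ)
    (hf₀' : ∀ v, 0 ≤ f₀ v ∧ f₀ v ≤ 1) :
    ∃ (f : ℕ → X → ℝ) (F : ℕ → Set X), f 0 = f₀ ∧ (∀ k, Integrable (f k) μ) ∧
      (∀ k v, 0 ≤ f k v ∧ f k v ≤ M ^ k) ∧ (∀ k v, f k v = 0 → f (k + 1) v = 0) ∧
      (∀ k, ∀ v ∉ F k, f (k + 1) v = 0) ∧
      (∀ k, ∀ s ∈ S k, |(∫ v in s, f (k + 1) v ∂μ) - ∫ v in s, f k v ∂μ| ≤ ε k) ∧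
      ∀ k, IsClosed (F k) ∧ P k (F k) := by
  have step : ∀ k (f : {f : X → ℝ // Integrable f μ}), ∃ (w : X → ℝ) (F : Set X),
      IsClosed F ∧ Measurable w ∧ (∀ v, 0 ≤ w v ∧ w v ≤ M) ∧ (∀ v ∉ F, w v = 0) ∧
      (∀ g ∈ (fun s : Set X => s.indicator f.1) '' S k,
        |(∫ v, g v * w v ∂μ) - ∫ v, g v ∂μ| ≤ ε k) ∧ P k F := by
    intro k f
    refine H k _ ((hS k).image _) ?_ (ε k) (hε k)
    rintro _ ⟨s, hs, rfl⟩
    exact f.2.indicator (hSm k s hs)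
  choose w F hFc hwm hwM hwF hwS hFP using step
  have hint (k : ℕ) (f : {f : X → ℝ // Integrable f μ}) :
      Integrable (fun v => f.1 v * w k f v) μ :=
    f.2.mul_bdd (c := M) (hwm k f).aestronglyMeasurable (ae_of_all _ fun v => by
      rw [Real.norm_eq_abs, abs_of_nonneg (hwM k f v).1]
      exact (hwM k f v).2)
  let φ : ℕ → {f : X → ℝ // Integrable f μ} := fun k =>
    Nat.rec ⟨f₀, hf₀⟩ (fun k f => ⟨fun v => f.1 v * w k f v, hint k f⟩) k
  have hφ (k : ℕ) (v : X) : (φ (k + 1)).1 v = (φ k).1 v * w k (φ k) v := rfl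
  refine ⟨fun k => (φ k).1, fun k => F k (φ k), rfl, fun k => (φ k).2, fun k v => ?_,
    fun k v hv => ?_, fun k v hv => ?_, fun k s hs => ?_, fun k => ⟨hFc _ _, hFP _ _⟩⟩ <;>
    beta_reduce at *
  · induction k with
    | zero => rw [pow_zero]; exact hf₀' v
    | succ k ih =>
      rw [hφ, pow_succ]
      obtain ⟨h0, h1⟩ := hwM k (φ k) v
      exact ⟨mul_nonneg ih.1 h0, mul_le_mul ih.2 h1 h0 (pow_nonneg (zero_le_one.trans hM) k)⟩
  · rw [hφ, hv, zero_mul]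
  · rw [hφ, hwF _ _ _ hv, mul_zero]
  · have := hwS k (φ k) _ ⟨s, hs, rfl⟩
    simp_rw [← indicator_mul_left] at this
    rwa [integral_indicator (hSm k s hs), integral_indicator (hSm k s hs)] at this

theorem withDensity_ofReal_apply {X : Type*} [MeasurableSpace X] {μ : Measure X} {f : X → ℝ}
    (hf : Integrable f μ) (hf0 : ∀ v, 0 ≤ f v) {s : Set X} (hs : MeasurableSet s) :
    μ.withDensity (fun v => ENNReal.ofReal (f v)) s = ENNReal.ofReal (∫ v in s, f v ∂μ) := by
  rw [withDensity_apply _ hs, ofReal_integral_eq_lintegral_ofReal hf.integrableOn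
    (ae_of_all _ hf0)]

theorem StrictMono.exists_le_lt_succ {J : ℕ → ℕ} (hJ : StrictMono J) {j : ℕ} (hj : J 0 ≤ j) :
    ∃ k, J k ≤ j ∧ j < J (k + 1) := by
  have hex : ∃ k, j < J (k + 1) := ⟨j, (Nat.lt_succ_self j).trans_le (hJ.le_apply)⟩
  refine ⟨Nat.find hex, ?_, Nat.find_spec hex⟩
  rcases hk : Nat.find hex with _ | k
  · exact hj
  · exact not_lt.1 (Nat.find_min hex (m := k) (by omega))

theorem exists_isCompact_gaugeMeasure_pos {h : ℝ → ℝ} (hdim : IsDimFun h)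
    (hprec : Prec h (fun x : ℝ => x ^ 2)) {P : ℕ → Set ℂ → Prop}
    (hP : ∀ i s t, s ⊆ t → P i t → P i s) {M : ℝ} (hM : 1 ≤ M)
    (H : ∀ i, ∀ T : Set (ℂ → ℝ), T.Finite → (∀ f ∈ T, Integrable f) → ∀ ε > 0,
      ∃ (w : ℂ → ℝ) (F : Set ℂ), IsClosed F ∧ Measurable w ∧ (∀ v, 0 ≤ w v ∧ w v ≤ M) ∧
        (∀ v ∉ F, w v = 0) ∧ (∀ f ∈ T, |(∫ v, f v * w v) - ∫ v, f v| ≤ ε) ∧ P i F) :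
    ∃ E : Set ℂ, IsCompact E ∧ 0 < gaugeMeasure h E ∧ ∀ i, P i E := by
  have hM0 : 0 < M := zero_lt_one.trans_le hM
  obtain ⟨J, hJ, hJh⟩ := hprec.exists_scales hdim (fun k => 72 * Real.pi * M ^ k)
    (fun k => by positivity)
  set Q : Set ℂ := Metric.closedBall 0 1
  have hQ : IsCompact Q := isCompact_closedBall 0 1
  have hnet : ∀ j : ℕ, ∃ N ⊆ Q, N.Finite ∧ Q ⊆ ⋃ p ∈ N, Metric.ball p ((1 / 2 : ℝ) ^ j) :=
    fun j => hQ.finite_cover_balls (by positivity)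
  choose N _ hNfin hNcov using hnet
  let S (i : ℕ) : Set (Set ℂ) := insert univ
    (⋃ j ∈ Iic (J (i + 1)), (fun p => Metric.ball p (3 * (1 / 2 : ℝ) ^ j)) '' N j)
  have hSfin (i : ℕ) : (S i).Finite :=
    (Finite.biUnion (finite_Iic _) fun j _ => (hNfin j).image _).insert _
  have hSm (i : ℕ) : ∀ s ∈ S i, MeasurableSet s := by
    rintro s (rfl | hs)
    · exact MeasurableSet.univ
    · simp only [mem_iUnion] at hs
      obtain ⟨j, _, p, _, rfl⟩ := hs
      exact measurableSet_ball
  let ε (i : ℕ) : ℝ := min 1 (h ((1 / 2 : ℝ) ^ J (i + 1))) * (1 / 2) ^ (i + 2)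
  have hε (i : ℕ) : 0 < ε i :=
    mul_pos (lt_min one_pos (hdim.2.1 _ (by positivity))) (by positivity)
  have hf₀ : Integrable (Q.indicator fun _ => (1 : ℝ)) :=
    (integrable_indicator_iff hQ.measurableSet).2 (integrableOn_const hQ.measure_ne_top)
  obtain ⟨f, F, hf0, hfi, hfb, hfz, hfF, hfS, hF⟩ := exists_densities hM H S hSfin hSm ε hε hf₀
    fun v => ⟨indicator_nonneg (fun _ _ => zero_le_one) v,
      indicator_apply_le' (fun _ => le_rfl) (fun _ => zero_le_one)⟩
  let E (k : ℕ) : Set ℂ := Q ∩ ⋂ i ∈ Iio k, F i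
  have hEanti : Antitone E := fun k l hkl => inter_subset_inter_right _
    (biInter_subset_biInter_left (Iio_subset_Iio hkl))
  have hEc (k : ℕ) : IsCompact (E k) :=
    hQ.inter_right (isClosed_biInter fun i _ => (hF i).1)
  have hfE : ∀ k, ∀ v ∉ E k, f k v = 0 := by
    intro k
    induction k with
    | zero =>
      intro v hv
      rw [hf0]
      exact indicator_of_notMem (fun hQv => hv ⟨hQv, by simp⟩) _
    | succ k ih =>
      intro v hv
      by_cases hvF : v ∈ F k
      · refine hfz k v (ih v fun hvE => hv ⟨hvE.1, ?_⟩)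
        simp only [mem_iInter, mem_Iio, Nat.lt_succ_iff_lt_or_eq]
        rintro i (hi | rfl)
        · exact mem_iInter₂.1 hvE.2 i hi
        · exact hvF
      · exact hfF k v hvF
  have hmass : ∀ k, 1 / 2 + (1 / 2) ^ (k + 1) ≤ ∫ v, f k v := by
    intro k
    induction k with
    | zero =>
      rw [hf0, integral_indicator hQ.measurableSet, setIntegral_const, smul_eq_mul, mul_one,
        Measure.real, Complex.volume_closedBall]
      simp only [ENNReal.ofReal_one, one_pow, one_mul, ENNReal.coe_toReal, NNReal.coe_real_pi]
      linarith [Real.pi_gt_three]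
    | succ k ih =>
      have h1 := hfS k univ (mem_insert _ _)
      rw [setIntegral_univ, setIntegral_univ] at h1
      have h2 : ε k ≤ 1 * (1 / 2) ^ (k + 2) :=
        mul_le_mul_of_nonneg_right (min_le_left _ _) (by positivity)
      have h3 := (abs_le.1 h1).1
      rw [pow_succ] at ih ⊢
      rw [pow_succ, pow_succ] at h2
      rw [pow_succ]
      linarith
  have hball : ∀ k x ρ, 0 < ρ → ρ ≤ (1 / 2 : ℝ) ^ J 0 → ∫ v in Metric.ball x ρ, f k v ≤ h ρ := by
    intro k x ρ hρ hρJ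
    have hhρ := hdim.2.1 ρ hρ
    by_cases hne : (Metric.ball x ρ ∩ Q).Nonempty
    swap
    · rw [setIntegral_eq_zero_of_forall_eq_zero fun v hv => hfE k v fun hvE => hne ⟨v, hv, hvE.1⟩]
      exact hhρ.le
    obtain ⟨q, hqx, hqQ⟩ := hne
    obtain ⟨j, hjρ, hρj⟩ := exists_nat_pow_near_of_lt_one hρ
      (hρJ.trans (pow_le_one₀ (by norm_num) (by norm_num))) (by norm_num : (0 : ℝ) < 1 / 2)
      (by norm_num)
    have hJj : J 0 ≤ j := Nat.lt_succ_iff.1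
      ((pow_lt_pow_iff_right_of_lt_one₀ (by norm_num) (by norm_num)).1 (hjρ.trans_le hρJ))
    obtain ⟨K, hKj, hjK⟩ := hJ.exists_le_lt_succ hJj
    obtain ⟨p, hpN, hqp⟩ := mem_iUnion₂.1 (hNcov j hqQ)
    set s : ℝ := (1 / 2 : ℝ) ^ j
    have hs : 0 < s := by positivity
    have hsρ : s ≤ 2 * ρ := by rw [pow_succ] at hjρ; linarith
    have hsub : Metric.ball x ρ ⊆ Metric.ball p (3 * s) := by
      intro v hv
      rw [Metric.mem_ball] at *
      have := dist_triangle4 v x q p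
      rw [dist_comm x q] at this
      linarith
    have hmono : ∫ v in Metric.ball x ρ, f k v ≤ ∫ v in Metric.ball p (3 * s), f k v :=
      setIntegral_mono_set (hfi k).integrableOn (ae_of_all _ fun v => (hfb k v).1)
        hsub.eventuallyLE
    refine hmono.trans ?_
    have hlow : ∀ k ≤ K, ∫ v in Metric.ball p (3 * s), f k v ≤ h ρ / 2 := by
      intro k hk
      calc ∫ v in Metric.ball p (3 * s), f k v
          ≤ ∫ v in Metric.ball p (3 * s), M ^ K :=
            setIntegral_mono (hfi k).integrableOn (integrableOn_const measure_ball_lt_top.ne)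
              fun v => (hfb k v).2.trans (pow_le_pow_right₀ hM hk)
        _ = 9 * Real.pi * M ^ K * s ^ 2 := by
            rw [setIntegral_const, smul_eq_mul, Measure.real, Complex.volume_ball,
              ENNReal.toReal_mul, ENNReal.toReal_pow, ENNReal.toReal_ofReal (by positivity)]
            simp only [ENNReal.coe_toReal, NNReal.coe_real_pi]
            ring
        _ ≤ 9 * Real.pi * M ^ K * (2 * ρ) ^ 2 := by gcongr
        _ = 72 * Real.pi * M ^ K * ρ ^ 2 / 2 := by ring
        _ ≤ h ρ / 2 := by
            have := hJh K ρ hρ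
              (hρj.trans (pow_le_pow_of_le_one (by norm_num) (by norm_num) hKj))
            linarith
    rcases le_total k K with hkK | hKk
    · linarith [hlow k hkK]
    obtain ⟨n, rfl⟩ := Nat.exists_eq_add_of_le hKk
    have hhigh : ∀ n, ∫ v in Metric.ball p (3 * s), f (K + n) v ≤
        h ρ / 2 + h ρ / 2 * (1 - (1 / 2) ^ n) := by
      intro n
      induction n with
      | zero => simpa using hlow K le_rfl
      | succ n ih =>
        have hJn : j + 1 ≤ J (K + n + 1) := hjK.trans_le (hJ.monotone (by omega))
        have h1 := hfS (K + n) (Metric.ball p (3 * s)) (mem_insert_of_mem _ (by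
          simp only [mem_iUnion]
          exact ⟨j, (Nat.le_succ j).trans hJn, p, hpN, rfl⟩))
        have h2 : ε (K + n) ≤ h ρ * (1 / 2) ^ (n + 2) := by
          refine mul_le_mul ((min_le_right _ _).trans ?_) ?_ (by positivity) hhρ.le
          · refine hdim.2.2.1 (mem_Ici.2 (by positivity)) (mem_Ici.2 hρ.le) (le_trans ?_ hjρ.le)
            exact pow_le_pow_of_le_one (by norm_num) (by norm_num) hJn
          · exact pow_le_pow_of_le_one (by norm_num) (by norm_num) (by omega)
        have h3 := (abs_le.1 h1).2
        rw [← add_assoc]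
        have h4 : h ρ * (1 / 2) ^ (n + 2) =
            h ρ / 2 * (1 - (1 / 2) ^ (n + 1)) - h ρ / 2 * (1 - (1 / 2) ^ n) := by ring
        linarith
    have h5 : h ρ / 2 * (1 - (1 / 2) ^ n) ≤ h ρ / 2 * 1 := by
      gcongr
      exact sub_le_self _ (by positivity)
    linarith [hhigh n]
  refine ⟨⋂ k, E k, (hEc 0).of_isClosed_subset (isClosed_iInter fun k => (hEc k).isClosed)
    (iInter_subset _ 0), ?_, fun i => ?_⟩
  · refine lt_of_lt_of_le (b := ENNReal.ofReal (1 / 2)) (by simp)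
      (le_gaugeMeasure_iInter hdim hEanti hEc
        (ν := fun k => volume.withDensity fun v => ENNReal.ofReal (f k v)) (fun k => ?_)
        (r := (1 / 2 : ℝ) ^ J 0) (by positivity) fun k x ρ hρ hρr => ?_)
    · rw [withDensity_ofReal_apply (hfi k) (fun v => (hfb k v).1) (hEc k).measurableSet,
        setIntegral_eq_integral_of_forall_compl_eq_zero (hfE k)]
      refine ENNReal.ofReal_le_ofReal (le_trans ?_ (hmass k))
      exact le_add_of_nonneg_right (by positivity)
    · rw [withDensity_ofReal_apply (hfi k) (fun v => (hfb k v).1) measurableSet_ball]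
      exact ENNReal.ofReal_le_ofReal (hball k x ρ hρ hρr)
  · exact hP i _ _ ((iInter_subset _ (i + 1)).trans
      (inter_subset_right.trans (biInter_subset_of_mem (mem_Iio.2 (Nat.lt_succ_self i))))) (hF i).2

open TopologicalSpace in
theorem exists_disjoint_countableBasis {X : Type*} [MetricSpace X] [SecondCountableTopology X]
    {a b c : X} (hab : a ≠ b) (hbc : b ≠ c) (hac : a ≠ c) :
    ∃ A B C : countableBasis X, a ∈ A.1 ∧ b ∈ B.1 ∧ c ∈ C.1 ∧
      Disjoint A.1 B.1 ∧ Disjoint B.1 C.1 ∧ Disjoint A.1 C.1 := by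
  have h₁ := dist_pos.2 hab
  have h₂ := dist_pos.2 hbc
  have h₃ := dist_pos.2 hac
  obtain ⟨r, hr, hr₁, hr₂, hr₃⟩ : ∃ r > 0, r + r ≤ dist a b ∧ r + r ≤ dist b c ∧ r + r ≤ dist a c :=
    ⟨min (dist a b) (min (dist b c) (dist a c)) / 2, by positivity, by simp, by simp, by simp⟩
  have hbasis (x : X) : ∃ A : countableBasis X, x ∈ A.1 ∧ A.1 ⊆ Metric.ball x r := by
    obtain ⟨A, hA, hx, hsub⟩ := (isBasis_countableBasis X).exists_subset_of_mem_open
      (Metric.mem_ball_self (x := x) hr) Metric.isOpen_ball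
    exact ⟨⟨A, hA⟩, hx, hsub⟩
  obtain ⟨A, haA, hA⟩ := hbasis a
  obtain ⟨B, hbB, hB⟩ := hbasis b
  obtain ⟨C, hcC, hC⟩ := hbasis c
  exact ⟨A, B, C, haA, hbB, hcC, (Metric.ball_disjoint_ball hr₁).mono hA hB,
    (Metric.ball_disjoint_ball hr₂).mono hB hC, (Metric.ball_disjoint_ball hr₃).mono hA hC⟩

open TopologicalSpace in
/-- Avoidance theorem: a compact set of positive gauge measure avoiding countably many linear
relations `⟪a, β₁ n⟫ - ⟪b, β₂ n⟫ + ⟪c, β₃ n⟫ = 0` on distinct points. -/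
theorem exists_isCompact_avoiding {h : ℝ → ℝ} (hdim : IsDimFun h)
    (hprec : Prec h (fun x : ℝ => x ^ 2)) (β₁ β₂ β₃ : ℕ → ℂ)
    (hβ : ∀ n, β₁ n ≠ 0 ∧ β₂ n ≠ 0 ∧ β₃ n ≠ 0) :
    ∃ E : Set ℂ, IsCompact E ∧ 0 < gaugeMeasure h E ∧
      ∀ n, ∀ a ∈ E, ∀ b ∈ E, ∀ c ∈ E, a ≠ b → b ≠ c → a ≠ c →
        inner ℝ a (β₁ n) - inner ℝ b (β₂ n) + inner ℝ c (β₃ n) ≠ 0 := by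
  obtain ⟨M, hM, hweight⟩ := exists_weight ℂ
  let ι := ℕ × countableBasis ℂ × countableBasis ℂ × countableBasis ℂ
  have : Countable (countableBasis ℂ) := (countable_countableBasis ℂ).to_subtype
  have : Nonempty (countableBasis ℂ) := by
    obtain ⟨A, hA, -⟩ := (isBasis_countableBasis ℂ).exists_subset_of_mem_open
      (mem_univ (0 : ℂ)) isOpen_univ
    exact ⟨⟨A, hA⟩⟩
  obtain ⟨e, he⟩ := exists_surjective_nat ι
  let R (n : ℕ) (A B C E : Set ℂ) : Prop := Disjoint A B → Disjoint B C → Disjoint A C →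
    ∀ a ∈ A ∩ E, ∀ b ∈ B ∩ E, ∀ c ∈ C ∩ E,
      inner ℝ a (β₁ n) - inner ℝ b (β₂ n) + inner ℝ c (β₃ n) ≠ 0
  obtain ⟨E, hE, hpos, hR⟩ := exists_isCompact_gaugeMeasure_pos hdim hprec
    (P := fun i E => R (e i).1 (e i).2.1 (e i).2.2.1 (e i).2.2.2 E)
    (fun i s t hst ht h₁ h₂ h₃ a ha b hb c hc => ht h₁ h₂ h₃ a ⟨ha.1, hst ha.2⟩ b
      ⟨hb.1, hst hb.2⟩ c ⟨hc.1, hst hc.2⟩) hM (by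
      intro i T hT hTi ε hε
      obtain ⟨n, A, B, C⟩ := e i
      have hopen (D : countableBasis ℂ) : IsOpen D.1 := isOpen_of_mem_countableBasis D.2
      by_cases hd : Disjoint A.1 B.1 ∧ Disjoint B.1 C.1 ∧ Disjoint A.1 C.1
      · obtain ⟨hAB, hBC, hAC⟩ := hd
        obtain ⟨w, F, hF, hw, hwM, hwF, hwT, hav⟩ := hweight A.1 B.1 C.1 (hopen A) (hopen B)
          (hopen C) hAB hBC hAC _ _ _ (hβ n).1 (hβ n).2.1 (hβ n).2.2 T hT hTi ε hε
        exact ⟨w, F, hF, hw, hwM, hwF, hwT, fun _ _ _ => hav⟩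
      · exact ⟨fun _ => 1, univ, isClosed_univ, measurable_const, fun _ => ⟨zero_le_one, hM⟩,
          fun v hv => (hv (mem_univ v)).elim, fun f _ => by simpa using hε.le,
          fun h₁ h₂ h₃ => (hd ⟨h₁, h₂, h₃⟩).elim⟩)
  refine ⟨E, hE, hpos, fun n a ha b hb c hc hab hbc hac => ?_⟩
  obtain ⟨A, B, C, haA, hbB, hcC, hAB, hBC, hAC⟩ := exists_disjoint_countableBasis hab hbc hac
  obtain ⟨i, hi⟩ := he (n, A, B, C)
  have := hR i
  rw [hi] at this
  exact this hAB hBC hAC a ⟨haA, ha⟩ b ⟨hbB, hb⟩ c ⟨hcC, hc⟩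

theorem stmt_19 (h : ℝ → ℝ) (hdim : IsDimFun h)
    (hprec : Prec h (fun x : ℝ => x ^ 2))
    (x y z : ℕ → ℂ) (hdist : ∀ n, x n ≠ y n ∧ y n ≠ z n ∧ x n ≠ z n) :
    ∃ E : Set ℂ, IsCompact E ∧ 0 < gaugeMeasure h E ∧
      ∀ n, ∀ a ∈ E, ∀ b ∈ E, ∀ c ∈ E, a ≠ b → b ≠ c → a ≠ c →
        ∀ w : ℂ, w ≠ 0 → ∀ t : ℂ,
          ¬ (a = w * x n + t ∧ b = w * y n + t ∧ c = w * z n + t) := by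
  have hzy (n : ℕ) : z n - y n ≠ 0 := sub_ne_zero.2 (hdist n).2.1.symm
  let α (n : ℕ) : ℂ := (z n - x n) / (z n - y n)
  have hα (n : ℕ) : α n ≠ 0 := div_ne_zero (sub_ne_zero.2 (hdist n).2.2.symm) (hzy n)
  have hα1 (n : ℕ) : α n - 1 ≠ 0 := by
    rw [sub_ne_zero, Ne, div_eq_one_iff_eq (hzy n), sub_right_inj]
    exact (hdist n).1
  obtain ⟨E, hE, hpos, hav⟩ := exists_isCompact_avoiding hdim hprec (fun _ => 1)
    (fun n => starRingEnd ℂ (α n)) (fun n => starRingEnd ℂ (α n - 1)) fun n =>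
      ⟨one_ne_zero, (map_ne_zero _).2 (hα n), (map_ne_zero _).2 (hα1 n)⟩
  refine ⟨E, hE, hpos, ?_⟩
  rintro n a ha b hb c hc hab hbc hac w - t ⟨rfl, rfl, rfl⟩
  refine hav n _ ha _ hb _ hc hab hbc hac ?_
  have hrel : (w * x n + t) - α n * (w * y n + t) + (α n - 1) * (w * z n + t) = 0 := by
    have : α n * (z n - y n) = z n - x n := div_mul_cancel₀ _ (hzy n)
    linear_combination w * this
  have hre := congrArg Complex.re hrel
  have hinner (u v : ℂ) : inner ℝ u (starRingEnd ℂ v) = (v * u).re := by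
    rw [Complex.inner, ← map_mul, Complex.conj_re, mul_comm]
  have hone (u : ℂ) : inner ℝ u (1 : ℂ) = u.re := by simp [Complex.inner]
  rw [hinner, hinner, hone]
  simpa using hre
end
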